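/- arXiv:1202.2668 — 2 statements merged into one kernel-verified Lean document; each statement's English description precedes it below -/
import Mathlib

section
/- Let e ≥ 2, s ∈ ℤ^l a multicharge and λ an l-partition. Then λ is a highest weight vertex of the crystal G_{e,s}, i.e. ε_i(λ) = 0 for every i ∈ ℤ/eℤ, if and only if (λ,s) is totally periodic, i.e. the peeling procedure applied to (λ,s) ends with the empty l-partition and a multicharge in T_{l,e}. -/
/- Formalization of combinatorial notions from
   "A combinatorial decomposition of higher level Fock spaces"
   by N. Jacon and C. Lecouvey. -/

open scoped Classical

noncomputable section

namespace FockHW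

/-- An `l`-partition, encoded by `P c i = λ^c_{i+1}` (`i` is the 0-based row index). -/
abbrev MP (l : ℕ) := Fin l → ℕ → ℕ

/-- A multicharge `s ∈ ℤ^l`. -/
abbrev Charge (l : ℕ) := Fin l → ℤ

/-- `P` is a genuine `l`-partition: each component is a weakly decreasing,
eventually zero, sequence of nonnegative integers. -/
def IsLPartition {l : ℕ} (P : MP l) : Prop :=
  (∀ c, Antitone (P c)) ∧ ∀ c, ∃ N, ∀ i, N ≤ i → P c i = 0

/-- The empty `l`-partition. -/
def emptyMP (l : ℕ) : MP l := fun _ _ => 0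

/-- The entry `B(λ,s)^c_{i+1} = λ^c_{i+1} - (i+1) + s_c + 1` of the symbol of `(λ,s)`. -/
def symb {l : ℕ} (P : MP l) (s : Charge l) (c : Fin l) (i : ℕ) : ℤ :=
  (P c i : ℤ) - (i : ℤ) + s c

/-- `v` is an entry of the `c`-th row of the symbol of `(P,s)`. -/
def RowHas {l : ℕ} (P : MP l) (s : Charge l) (c : Fin l) (v : ℤ) : Prop :=
  ∃ i, symb P s c i = v

/-- `k` is the largest entry of the symbol of `(P,s)`. -/
def IsMaxEntry {l : ℕ} (P : MP l) (s : Charge l) (k : ℤ) : Prop :=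
  (∃ c, RowHas P s c k) ∧ ∀ c v, RowHas P s c v → v ≤ k

/-- The data `(k, per)` is an `e`-period of the symbol of `(P,s)`:
`k` is the largest entry, the rows `per 0 ≥ per 1 ≥ …` carry the entries
`k, k-1, …, k-e+1`, and no entry `k-t` occurs in a row strictly below `per t`. -/
def IsEPeriod {l : ℕ} (e : ℕ) (P : MP l) (s : Charge l) (k : ℤ) (per : Fin e → Fin l) : Prop :=
  IsMaxEntry P s k ∧ Antitone per ∧
  ∀ t : Fin e, RowHas P s (per t) (k - ((t : ℕ) : ℤ)) ∧
    ∀ d : Fin l, RowHas P s d (k - ((t : ℕ) : ℤ)) → per t ≤ d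

/-- `(P,s)` is `e`-periodic. -/
def EPeriodic {l : ℕ} (e : ℕ) (P : MP l) (s : Charge l) : Prop :=
  ∃ k per, IsEPeriod e P s k per

/-- `(P',s')` is obtained from `(P,s)` by deleting the `e`-period with data `(k, per)`:
rowwise, the entries of the new symbol are the old ones minus the period entries. -/
def DeletesToWith {l : ℕ} (e : ℕ) (P : MP l) (s : Charge l) (k : ℤ) (per : Fin e → Fin l)
    (P' : MP l) (s' : Charge l) : Prop :=
  IsEPeriod e P s k per ∧ IsLPartition P' ∧
  ∀ d : Fin l, {v : ℤ | RowHas P' s' d v} =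
    {v : ℤ | RowHas P s d v} \ {v : ℤ | ∃ t : Fin e, per t = d ∧ v = k - ((t : ℕ) : ℤ)}

/-- `(P',s')` is obtained from `(P,s)` by deleting the `e`-period. -/
def DeletesTo {l : ℕ} (e : ℕ) (P : MP l) (s : Charge l) (P' : MP l) (s' : Charge l) : Prop :=
  ∃ k per, DeletesToWith e P s k per P' s'

/-- One step of the map `(λ,s) ↦ (λ⁻,s⁻)`: delete the `e`-period if `(λ,s)` is
`e`-periodic, do nothing otherwise. -/
def DeleteStep {l : ℕ} (e : ℕ) (P : MP l) (s : Charge l) (P' : MP l) (s' : Charge l) : Prop :=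
  (¬ EPeriodic e P s ∧ P' = P ∧ s' = s) ∨ DeletesTo e P s P' s'

/-- The set `T_{l,e}` of weakly increasing multicharges with spread at most `e-1`. -/
def Tle (l e : ℕ) : Set (Charge l) :=
  {t | Monotone t ∧ ∀ c d : Fin l, t d - t c ≤ (e : ℤ) - 1}

/-- The peeling procedure applied to `(P,s)` terminates at `(∅,t)`:
there is a chain of `e`-period deletions from `(P,s)` to `(∅,t)` with `t ∈ T_{l,e}`,
not passing through any `(∅,t')` with `t' ∈ T_{l,e}` earlier (so `λ° = ∅`, `s° = t`). -/
def PeelChainTo {l : ℕ} (e : ℕ) (P : MP l) (s : Charge l) (t : Charge l) : Prop :=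
  t ∈ Tle l e ∧ ∃ (n : ℕ) (g : ℕ → MP l × Charge l), g 0 = (P, s) ∧
    (∀ m, m < n → ¬((g m).1 = emptyMP l ∧ (g m).2 ∈ Tle l e) ∧
      DeletesTo e (g m).1 (g m).2 (g (m+1)).1 (g (m+1)).2) ∧
    g n = (emptyMP l, t)

/-- `(P,s)` is totally periodic: the peeling procedure ends with the empty
`l`-partition and a multicharge in `T_{l,e}`. -/
def TotallyPeriodic {l : ℕ} (e : ℕ) (P : MP l) (s : Charge l) : Prop :=
  ∃ t, PeelChainTo e P s t

/-- Indicator (valued in `ℤ`) of an addable node of content `x` in component `c`. -/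
def addA {l : ℕ} (P : MP l) (s : Charge l) (c : Fin l) (x : ℤ) : ℤ :=
  if RowHas P s c x ∧ ¬ RowHas P s c (x + 1) then 1 else 0

/-- Indicator (valued in `ℤ`) of a removable node of content `x` in component `c`. -/
def remR {l : ℕ} (P : MP l) (s : Charge l) (c : Fin l) (x : ℤ) : ℤ :=
  if RowHas P s c (x + 1) ∧ ¬ RowHas P s c x then 1 else 0

/-- `#R - #A` on the suffix of the `j`-word (`e = ∞`) starting at the node of
content `j` in component `c0` (the `j`-word is ordered by decreasing component). -/
def suffInf {l : ℕ} (P : MP l) (s : Charge l) (j : ℤ) (c0 : Fin l) : ℤ :=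
  ∑ c ∈ Finset.univ.filter (fun c : Fin l => c ≤ c0), (remR P s c j - addA P s c j)

/-- `#A - #R` on the prefix of the `j`-word (`e = ∞`) ending at the node of
content `j` in component `c0`. -/
def prefInf {l : ℕ} (P : MP l) (s : Charge l) (j : ℤ) (c0 : Fin l) : ℤ :=
  ∑ c ∈ Finset.univ.filter (fun c : Fin l => c0 ≤ c), (addA P s c j - remR P s c j)

/-- `ε^∞_j(λ)`: the number of `R`'s in the reduced `j`-word of `λ` (`e = ∞`),
computed as the largest value of `#R - #A` over suffixes of the `j`-word. -/
def epsInf {l : ℕ} (P : MP l) (s : Charge l) (j : ℤ) : ℤ :=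
  sSup (insert 0 {z : ℤ | ∃ c0, z = suffInf P s j c0})

/-- `φ^∞_j(λ)`: the number of `A`'s in the reduced `j`-word of `λ` (`e = ∞`). -/
def phiInf {l : ℕ} (P : MP l) (s : Charge l) (j : ℤ) : ℤ :=
  sSup (insert 0 {z : ℤ | ∃ c0, z = prefInf P s j c0})

/-- The `sl∞`-weight `wt(λ,s)_∞ = Σ_j (φ^∞_j - ε^∞_j) Λ_j` of `(λ,s)`,
as a function giving the coordinate on each `Λ_j`. -/
def wtInf {l : ℕ} (P : MP l) (s : Charge l) : ℤ → ℤ :=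
  fun j => phiInf P s j - epsInf P s j

/-- `#R - #A` on the suffix of the `i`-word (residues mod `e`) starting at the
node of content `x0` in component `c0`. -/
def suffE {l : ℕ} (e : ℕ) (P : MP l) (s : Charge l) (i : ZMod e) (x0 : ℤ) (c0 : Fin l) : ℤ :=
  ∑ᶠ x : ℤ, if (x : ZMod e) = i then
      (if x0 < x then ∑ c : Fin l, (remR P s c x - addA P s c x)
       else if x = x0 then suffInf P s x c0 else 0)
    else 0

/-- `#A - #R` on the prefix of the `i`-word ending at the node of content `x0`
in component `c0`. -/
def prefE {l : ℕ} (e : ℕ) (P : MP l) (s : Charge l) (i : ZMod e) (x0 : ℤ) (c0 : Fin l) : ℤ :=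
  ∑ᶠ x : ℤ, if (x : ZMod e) = i then
      (if x < x0 then ∑ c : Fin l, (addA P s c x - remR P s c x)
       else if x = x0 then prefInf P s x c0 else 0)
    else 0

/-- `ε_i(λ)`: the number of `R`'s in the reduced `i`-word of `λ`, computed as the
largest value of `#R - #A` over suffixes of the `i`-word. -/
def epsE {l : ℕ} (e : ℕ) (P : MP l) (s : Charge l) (i : ZMod e) : ℤ :=
  sSup (insert 0 {z : ℤ | ∃ x0 c0, z = suffE e P s i x0 c0})

/-- `φ_i(λ)`: the number of `A`'s in the reduced `i`-word of `λ`. -/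
def phiE {l : ℕ} (e : ℕ) (P : MP l) (s : Charge l) (i : ZMod e) : ℤ :=
  sSup (insert 0 {z : ℤ | ∃ x0 c0, z = prefE e P s i x0 c0})

/-- The fundamental weight `Λ_{j0}` of `P_∞`, as a coordinate function. -/
def Lam (j0 : ℤ) : ℤ → ℤ := fun j => if j = j0 then 1 else 0

/-- The level-zero weight `ω_k = Λ_{k+1} - Λ_{k-e+1}`. -/
def omegaW (e : ℕ) (k : ℤ) : ℤ → ℤ := fun j => Lam (k + 1) j - Lam (k - (e : ℤ) + 1) j

/-- `Λ_{t,∞} = Λ_{t_0} + … + Λ_{t_{l-1}}`. -/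
def LamCh {l : ℕ} (t : Charge l) : ℤ → ℤ := fun j => ∑ c : Fin l, Lam (t c) j

/-- The node of content `x` in component `c` is the good addable `i`-node of `λ`:
it is addable, of residue `i`, and it is the leftmost node in the `i`-word at which
the prefix count `#A - #R` attains its maximum `φ_i(λ)` (equivalently it corresponds
to the rightmost `A` of the reduced `i`-word). -/
def IsGoodAddableE {l : ℕ} (e : ℕ) (P : MP l) (s : Charge l) (i : ZMod e)
    (x : ℤ) (c : Fin l) : Prop :=
  addA P s c x = 1 ∧ (x : ZMod e) = i ∧ prefE e P s i x c = phiE e P s i ∧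
  ∀ (x' : ℤ) (c' : Fin l), addA P s c' x' = 1 → (x' : ZMod e) = i →
    prefE e P s i x' c' = phiE e P s i → (x < x' ∨ (x = x' ∧ c' ≤ c))

/-- The node of content `x` in component `c` is the good addable `x`-node of `λ`
for the `e = ∞` structure. -/
def IsGoodAddableInf {l : ℕ} (P : MP l) (s : Charge l) (x : ℤ) (c : Fin l) : Prop :=
  addA P s c x = 1 ∧ prefInf P s x c = phiInf P s x ∧
  ∀ c' : Fin l, addA P s c' x = 1 → prefInf P s x c' = phiInf P s x → c' ≤ c

/-- One step of the `RA`-cancellation: the state is a reduced word `A^p R^q`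
(encoded `(p,q)`), and a new letter (`true` = `A`, `false` = `R`) is appended. -/
def reduceStep : ℕ × ℕ → Bool → ℕ × ℕ
  | (p, q), true => if q = 0 then (p + 1, 0) else (p, q - 1)
  | (p, q), false => (p, q + 1)

/-- The result `A^p R^q` of recursively deleting the factors `RA` in a word
(`true` = `A`, `false` = `R`). -/
def reduceRA (w : List Bool) : ℕ × ℕ := w.foldl reduceStep (0, 0)

/-- The word `u_j`: reading the entries `j` and `j+1` of the symbol, rows from
top to bottom, each row from right to left, encoding `j` by `A` and `j+1` by `R`. -/
def ujWord {l : ℕ} (P : MP l) (s : Charge l) (j : ℤ) : List Bool :=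
  ((List.finRange l).reverse.map (fun c =>
    (if RowHas P s c (j + 1) then [false] else []) ++
    (if RowHas P s c j then [true] else []))).flatten

/-- The word `u_i = u_{jlow} u_{jlow+e} u_{jlow+2e} ⋯` (truncated after `B` factors). -/
def uiWord {l : ℕ} (e : ℕ) (P : MP l) (s : Charge l) (jlow : ℤ) (B : ℕ) : List Bool :=
  ((List.range B).map (fun tt => ujWord P s (jlow + (tt : ℤ) * (e : ℤ)))).flatten

/-- `m` is admissible for the symbol of `(P,s)`: every row contains every integer `< m`. -/
def Admissible {l : ℕ} (P : MP l) (s : Charge l) (m : ℤ) : Prop :=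
  ∀ c, ∀ v : ℤ, v < m → RowHas P s c v

/-- The number of entries `≥ m` in row `c` of the symbol of `(P,s)`. -/
def nGE {l : ℕ} (P : MP l) (s : Charge l) (c : Fin l) (m : ℤ) : ℕ :=
  {i : ℕ | m ≤ symb P s c i}.ncard

/-- The symbol of `(P,s)` is semistandard: for every admissible `m` and every `j`,
the `j`-th smallest entry `≥ m` of row `c` is at least the `j`-th smallest entry
`≥ m` of row `c+1`, whenever both are defined. -/
def Semistandard {l : ℕ} (P : MP l) (s : Charge l) : Prop :=
  ∀ m : ℤ, Admissible P s m → ∀ c : Fin l, ∀ hc : (c : ℕ) + 1 < l, ∀ j : ℕ,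
    1 ≤ j → j ≤ nGE P s c m → j ≤ nGE P s ⟨(c : ℕ) + 1, hc⟩ m →
    symb P s ⟨(c : ℕ) + 1, hc⟩ (nGE P s ⟨(c : ℕ) + 1, hc⟩ m - j) ≤
      symb P s c (nGE P s c m - j)

/-- The box in row `c`, column `x`, belongs to the skew shape `u∖t`. -/
def InShape {l : ℕ} (u t : Charge l) (c : Fin l) (x : ℤ) : Prop := t c < x ∧ x ≤ u c

/-- `τ` is a skew (semistandard) tableau of shape `u∖t` (normalized by `0` outside
the shape): rows strictly increase from left to right, columns weakly increase
from top (row `l-1`) to bottom (row `0`). -/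
def IsSkewTableau {l : ℕ} (u t : Charge l) (τ : Fin l → ℤ → ℤ) : Prop :=
  (∀ c x, ¬ InShape u t c x → τ c x = 0) ∧
  (∀ c x, InShape u t c x → InShape u t c (x + 1) → τ c x < τ c (x + 1)) ∧
  (∀ (c : Fin l) (hc : (c : ℕ) + 1 < l) (x : ℤ),
    InShape u t c x → InShape u t ⟨(c : ℕ) + 1, hc⟩ x → τ ⟨(c : ℕ) + 1, hc⟩ x ≤ τ c x)

/-- The box `b` is read strictly before the box `b'` in the reading word of a skew
tableau (rows from top to bottom, right to left within each row). -/
def ReadBefore {l : ℕ} (b b' : Fin l × ℤ) : Prop :=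
  b'.1 < b.1 ∨ (b.1 = b'.1 ∧ b'.2 < b.2)

/-- `(M, q)` is the `e`-period of the skew tableau `τ` of shape `u∖t`:
`M` is the largest entry, `q k` is the last box in reading order with entry `M-k`,
and these boxes occur in increasing reading order. -/
def IsTabPeriod {l : ℕ} (e : ℕ) (u t : Charge l) (τ : Fin l → ℤ → ℤ) (M : ℤ)
    (q : Fin e → Fin l × ℤ) : Prop :=
  (∃ c x, InShape u t c x ∧ τ c x = M) ∧
  (∀ c x, InShape u t c x → τ c x ≤ M) ∧
  (∀ k : Fin e, InShape u t (q k).1 (q k).2 ∧ τ (q k).1 (q k).2 = M - ((k : ℕ) : ℤ) ∧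
    ∀ c x, InShape u t c x → τ c x = M - ((k : ℕ) : ℤ) → (c, x) ≠ q k →
      ReadBefore (c, x) (q k)) ∧
  ∀ (k : Fin e) (hk : (k : ℕ) + 1 < e), ReadBefore (q k) (q ⟨(k : ℕ) + 1, hk⟩)

/-- `(u',τ')` is obtained from the skew tableau `(u,τ)` (inner shape `t`) by deleting
the boxes of its `e`-period. -/
def TabDeletesTo {l : ℕ} (e : ℕ) (u t : Charge l) (τ : Fin l → ℤ → ℤ)
    (u' : Charge l) (τ' : Fin l → ℤ → ℤ) : Prop :=
  ∃ M q, IsTabPeriod e u t τ M q ∧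
    (∀ c : Fin l, u' c = u c - ((Finset.univ.filter (fun k : Fin e => (q k).1 = c)).card : ℤ)) ∧
    (∀ k : Fin e, u' (q k).1 < (q k).2) ∧
    τ' = fun c x => if InShape u' t c x then τ c x else 0

/-- The trivial tableau of shape `u∖t`: row `c` contains `t_c+1, …, u_c`. -/
def trivialTab {l : ℕ} (u t : Charge l) : Fin l → ℤ → ℤ :=
  fun c x => if InShape u t c x then x else 0

/-- The skew tableau `τ` of shape `u∖t` is totally `e`-periodic: iterated deletion of
`e`-periods (never stopping early at a trivial tableau with charge in `T_{l,e}`)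
empties the tableau. -/
def TabTotallyPeriodic {l : ℕ} (e : ℕ) (u t : Charge l) (τ : Fin l → ℤ → ℤ) : Prop :=
  ∃ (n : ℕ) (G : ℕ → Charge l × (Fin l → ℤ → ℤ)), G 0 = (u, τ) ∧
    (∀ m, m < n → ¬((G m).2 = trivialTab (G m).1 t ∧ (G m).1 ∈ Tle l e) ∧
      TabDeletesTo e (G m).1 t (G m).2 (G (m+1)).1 (G (m+1)).2) ∧
    (G n).1 = t

/-- The set `Tab^e_{u∖t}` of totally periodic skew tableaux of shape `u∖t`
(row `c` contains only integers `> t_c`). -/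
def TabSet {l : ℕ} (e : ℕ) (u t : Charge l) : Set (Fin l → ℤ → ℤ) :=
  {τ | IsSkewTableau u t τ ∧ (∀ c x, InShape u t c x → t c < τ c x) ∧
       TabTotallyPeriodic e u t τ}

/-- The `sl∞`-weight `wt(τ)_∞ = Σ_b ε_{τ(b)}` of a skew tableau, as a coordinate
function on the `Λ_j`. -/
def wtTab {l : ℕ} (u t : Charge l) (τ : Fin l → ℤ → ℤ) : ℤ → ℤ :=
  fun j => ({p : Fin l × ℤ | InShape u t p.1 p.2 ∧ τ p.1 p.2 = j - 1}.ncard : ℤ)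
         - ({p : Fin l × ℤ | InShape u t p.1 p.2 ∧ τ p.1 p.2 = j}.ncard : ℤ)

/-- `Tab^e_{u∖t,γ}`: totally periodic skew tableaux of shape `u∖t` and weight `γ`. -/
def TabSetWt {l : ℕ} (e : ℕ) (u t : Charge l) (γ : ℤ → ℤ) : Set (Fin l → ℤ → ℤ) :=
  {τ ∈ TabSet e u t | wtTab u t τ = γ}

/-- The level-`0` part `B(λ,s)_0` of a symbol: the skew tableau of shape `s∖t`
whose row `c` lists, in increasing order, the entries `> t_c` of row `c` of the
symbol of `(P,s)` (these are the entries deleted during the peeling when `s° = t`). -/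
def level0 {l : ℕ} (P : MP l) (s t : Charge l) : Fin l → ℤ → ℤ :=
  fun c x =>
    if t c < x ∧ x ≤ s c then
      sInf {u : ℤ | RowHas P s c u ∧ t c < u ∧
        ({v : ℤ | RowHas P s c v ∧ t c < v ∧ v ≤ u}.ncard : ℤ) = x - t c}
    else 0

/-- The Young diagram `λ(v)`: the conjugate of the partition
`(v_{l-1}-v_0, v_{l-2}-v_0, …, v_1-v_0)`, as a set of boxes `(row, column)`. -/
def lamShape {l : ℕ} (hl : 0 < l) (v : Charge l) : Set (ℕ × ℕ) :=
  {rc | rc.2 + 1 < l ∧ (rc.1 : ℤ) < v ⟨l - 1 - rc.2, by omega⟩ - v ⟨0, hl⟩}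

/-- The set of semistandard Young tableaux of shape `λ(v)` and weight
`μ(v) = (s_0 - v_0, …, s_{l-1} - v_0)`; its cardinality is the Kostka number
`K_{λ(v),μ(v)}`. -/
def KostkaSet {l : ℕ} (hl : 0 < l) (v s : Charge l) : Set (ℕ → ℕ → ℕ) :=
  {T | (∀ r c, (r, c) ∉ lamShape hl v → T r c = 0) ∧
       (∀ r c, (r, c) ∈ lamShape hl v → 1 ≤ T r c ∧ T r c ≤ l) ∧
       (∀ r c, (r, c) ∈ lamShape hl v → (r, c + 1) ∈ lamShape hl v → T r c ≤ T r (c + 1)) ∧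
       (∀ r c, (r, c) ∈ lamShape hl v → (r + 1, c) ∈ lamShape hl v → T r c < T (r + 1) c) ∧
       ∀ cc : Fin l,
         (({rc : ℕ × ℕ | rc ∈ lamShape hl v ∧ T rc.1 rc.2 = (cc : ℕ) + 1}.ncard : ℤ))
           = s cc - v ⟨0, hl⟩}

/-- `w` is a reverse lattice (Yamanouchi) word: it can be decomposed into disjoint
subwords of the form `a (a-1) (a-2) ⋯ min(w)`. -/
def IsReverseLatticeWord (w : List ℤ) : Prop :=
  w = [] ∨ ∃ mn : ℤ, mn ∈ w ∧ (∀ x ∈ w, mn ≤ x) ∧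
    ∃ (r : ℕ) (col : Fin w.length → Fin r) (a : Fin r → ℤ),
      (∀ p : Fin w.length,
        w.get p = a (col p) -
          ((Finset.univ.filter (fun q : Fin w.length => q < p ∧ col q = col p)).card : ℤ)) ∧
      ∀ jj : Fin r,
        ((Finset.univ.filter (fun p : Fin w.length => col p = jj)).card : ℤ) = a jj - mn + 1

/-- The word obtained by reading the entries `≥ m` of the symbol of `(P,s)`,
rows from top to bottom, each row from right to left (i.e. in decreasing order). -/
def readWordGE {l : ℕ} (P : MP l) (s : Charge l) (m : ℤ) : List ℤ :=
  ((List.finRange l).reverse.map (fun c =>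
     (List.range (nGE P s c m)).map (fun i => symb P s c i))).flatten


section Rows

variable {l e : ℕ} {P : MP l}

theorem exists_forall_rowHas_le (hP : IsLPartition P) (s : Charge l) :
    ∃ K : ℤ, ∀ c v, RowHas P s c v → v ≤ K := by
  obtain ⟨K, hK⟩ := (Set.finite_range fun c => (P c 0 : ℤ) + s c).bddAbove
  refine ⟨K, ?_⟩
  rintro c v ⟨i, rfl⟩
  have h1 : (P c 0 : ℤ) + s c ≤ K := hK ⟨c, rfl⟩
  have h2 : P c i ≤ P c 0 := hP.1 c (Nat.zero_le i)
  simp only [symb]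
  omega

theorem exists_forall_le_rowHas (hP : IsLPartition P) (s : Charge l) :
    ∃ m : ℤ, ∀ c v, v ≤ m → RowHas P s c v := by
  choose N hN using hP.2
  obtain ⟨m, hm⟩ := (Set.finite_range fun c => s c - (N c : ℤ)).bddBelow
  refine ⟨m, fun c v hv => ⟨(s c - v).toNat, ?_⟩⟩
  have h1 : m ≤ s c - (N c : ℤ) := hm ⟨c, rfl⟩
  simp only [symb]
  rw [hN c _ (by omega)]
  omega

theorem exists_isMaxEntry (hl : 0 < l) (hP : IsLPartition P) (s : Charge l) :
    ∃ k, IsMaxEntry P s k := by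
  obtain ⟨K, hK⟩ := exists_forall_rowHas_le hP s
  obtain ⟨m, hm⟩ := exists_forall_le_rowHas hP s
  obtain ⟨k, hk, hk'⟩ := Int.exists_greatest_of_bdd (P := fun v => ∃ c, RowHas P s c v)
    ⟨K, fun z ⟨c, h⟩ => hK c z h⟩ ⟨m, ⟨0, hl⟩, hm _ _ le_rfl⟩
  exact ⟨k, hk, fun c v h => hk' v ⟨c, h⟩⟩

theorem rowHas_emptyMP {s : Charge l} {c : Fin l} {v : ℤ} :
    RowHas (emptyMP l) s c v ↔ v ≤ s c := by
  constructor
  · rintro ⟨i, rfl⟩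
    simp only [symb, emptyMP]
    omega
  · intro h
    refine ⟨(s c - v).toNat, ?_⟩
    simp only [symb, emptyMP]
    omega

/-- Deleting one entry of a strictly decreasing row yields again a row of this kind. -/
theorem exists_row_erase {p : ℕ → ℕ} (hp : Antitone p) (h0 : ∃ N, ∀ i, N ≤ i → p i = 0)
    (a : ℤ) (n : ℕ) :
    ∃ (p' : ℕ → ℕ) (a' : ℤ), Antitone p' ∧ (∃ N, ∀ i, N ≤ i → p' i = 0) ∧
      ∀ v : ℤ, (∃ i, (p' i : ℤ) - i + a' = v) ↔
        (∃ i, (p i : ℤ) - i + a = v) ∧ v ≠ (p n : ℤ) - n + a := by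
  obtain ⟨N, hN⟩ := h0
  refine ⟨fun j => if j < n then p j + 1 else p (j + 1), a - 1, ?_, ⟨max N n, ?_⟩, ?_⟩
  · refine antitone_nat_of_succ_le fun j => ?_
    have h1 := hp (Nat.le_succ j)
    have h2 := hp (Nat.le_succ (j + 1))
    simp only [Nat.succ_eq_add_one] at h1 h2
    split_ifs <;> omega
  · intro i hi
    exact (if_neg (by omega)).trans (hN (i + 1) (by omega))
  · intro v
    constructor
    · rintro ⟨i, rfl⟩
      dsimp only
      split_ifs with h
      · have := hp h.le
        refine ⟨⟨i, by push_cast; ring⟩, ?_⟩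
        push_cast
        omega
      · have := hp (show n ≤ i + 1 by omega)
        refine ⟨⟨i + 1, by push_cast; ring⟩, ?_⟩
        omega
    · rintro ⟨⟨i, rfl⟩, hne⟩
      rcases lt_trichotomy i n with h | rfl | h
      · refine ⟨i, ?_⟩
        dsimp only
        rw [if_pos h]
        push_cast
        ring
      · exact absurd rfl hne
      · obtain ⟨j, rfl⟩ : ∃ j, i = j + 1 := ⟨i - 1, by omega⟩
        refine ⟨j, ?_⟩
        dsimp only
        rw [if_neg (by omega)]
        push_cast
        ring

theorem exists_row_sdiff {p : ℕ → ℕ} (hp : Antitone p) (h0 : ∃ N, ∀ i, N ≤ i → p i = 0)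
    (a : ℤ) (T : Finset ℤ) :
    ∃ (p' : ℕ → ℕ) (a' : ℤ), Antitone p' ∧ (∃ N, ∀ i, N ≤ i → p' i = 0) ∧
      ∀ v : ℤ, (∃ i, (p' i : ℤ) - i + a' = v) ↔
        (∃ i, (p i : ℤ) - i + a = v) ∧ v ∉ T := by
  induction T using Finset.induction_on with
  | empty => exact ⟨p, a, hp, h0, by simp⟩
  | insert b T _ ih =>
    obtain ⟨q, a', hq, hq0, H⟩ := ih
    by_cases hb : ∃ i, (q i : ℤ) - i + a' = b
    · obtain ⟨n, rfl⟩ := hb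
      obtain ⟨r, a'', hr, hr0, H'⟩ := exists_row_erase hq hq0 a' n
      refine ⟨r, a'', hr, hr0, fun v => ?_⟩
      rw [H', H, Finset.mem_insert]
      tauto
    · refine ⟨q, a', hq, hq0, fun v => ?_⟩
      rw [H, Finset.mem_insert]
      constructor
      · rintro ⟨h1, h2⟩
        refine ⟨h1, ?_⟩
        rintro (rfl | h)
        · exact hb ((H _).2 ⟨h1, h2⟩)
        · exact h2 h
      · tauto

theorem exists_deletesToWith {s : Charge l} {k : ℤ} {per : Fin e → Fin l} (hP : IsLPartition P)
    (h : IsEPeriod e P s k per) : ∃ P' s', DeletesToWith e P s k per P' s' := by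
  have H := fun d => exists_row_sdiff (hP.1 d) (hP.2 d) (s d)
    ((Finset.univ.filter fun t : Fin e => per t = d).image fun t : Fin e => k - ((t : ℕ) : ℤ))
  choose P' s' h1 h2 h3 using H
  refine ⟨P', s', h, ⟨h1, h2⟩, fun d => Set.ext fun v => ?_⟩
  refine (h3 d v).trans ?_
  simp only [RowHas, symb, Set.mem_sdiff, Set.mem_ofPred_eq, Finset.mem_image, Finset.mem_filter,
    Finset.mem_univ, true_and, eq_comm]

theorem DeletesToWith.rowHas_iff {s s' : Charge l} {P' : MP l} {k : ℤ} {per : Fin e → Fin l}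
    (h : DeletesToWith e P s k per P' s') (d : Fin l) (v : ℤ) :
    RowHas P' s' d v ↔ RowHas P s d v ∧ ¬ ∃ t : Fin e, per t = d ∧ v = k - ((t : ℕ) : ℤ) :=
  Set.ext_iff.1 (h.2.2 d) v

end Rows

section Tail

variable {l e : ℕ} {P : MP l} {s : Charge l}

/-- The entries of the symbol congruent to `x` mod `e` and either larger than `x`, or equal to `x`
and lying in a row weakly below `c`; the entry `x + j * e` of row `d` is encoded by `(d, j)`. -/
def tailSet (e : ℕ) (P : MP l) (s : Charge l) (x : ℤ) (c : Fin l) : Set (Fin l × ℕ) :=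
  {q | RowHas P s q.1 (x + q.2 * e) ∧ (q.2 = 0 → q.1 ≤ c)}

/-- The sizes of the sets `tailSet e P s x c` decrease weakly in `x`. -/
def TailAntitone (e : ℕ) (P : MP l) (s : Charge l) : Prop :=
  ∀ x c, (tailSet e P s (x + 1) c).ncard ≤ (tailSet e P s x c).ncard

theorem tailSet_eq_coe_filter {K x : ℤ} (hK : ∀ c v, RowHas P s c v → v ≤ K) {N : ℕ}
    (hN : K < x + N * e) (c : Fin l) :
    tailSet e P s x c = ↑((Finset.univ ×ˢ Finset.range N).filter fun q : Fin l × ℕ =>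
      RowHas P s q.1 (x + q.2 * e) ∧ (q.2 = 0 → q.1 ≤ c)) := by
  ext ⟨d, j⟩
  simp only [tailSet, Set.mem_ofPred_eq, Finset.coe_filter, Finset.mem_product, Finset.mem_univ,
    Finset.mem_range, true_and, iff_and_self]
  intro h
  have h1 := hK _ _ h.1
  by_contra! hj
  have : (N : ℤ) * e ≤ j * e := by gcongr
  omega

theorem exists_lt_add_mul (he : 0 < e) (K x : ℤ) : ∃ N : ℕ, K < x + N * e := by
  refine ⟨(K - x).toNat + 1, ?_⟩
  have : ((K - x).toNat + 1 : ℤ) * 1 ≤ ((K - x).toNat + 1 : ℤ) * e := by gcongr; omega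
  push_cast
  omega

theorem tailSet_finite (he : 0 < e) (hP : IsLPartition P) (x : ℤ) (c : Fin l) :
    (tailSet e P s x c).Finite := by
  obtain ⟨K, hK⟩ := exists_forall_rowHas_le hP s
  obtain ⟨N, hN⟩ := exists_lt_add_mul he K x
  rw [tailSet_eq_coe_filter hK hN]
  exact Finset.finite_toSet _

theorem TailAntitone.nonempty (he : 0 < e) (hP : IsLPartition P) (h : TailAntitone e P s)
    {x : ℤ} {c : Fin l} (hx : (tailSet e P s (x + 1) c).Nonempty) :
    (tailSet e P s x c).Nonempty := by
  rw [← Set.ncard_pos (tailSet_finite he hP _ _)] at hx ⊢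
  exact hx.trans_le (h x c)

theorem TailAntitone.exists_rowHas_le (he : 0 < e) (hP : IsLPartition P) (h : TailAntitone e P s)
    {K x : ℤ} (hK : ∀ c v, RowHas P s c v → v ≤ K) (hx : K < x + e) {c : Fin l}
    (hc : RowHas P s c (x + 1)) : ∃ d ≤ c, RowHas P s d x := by
  obtain ⟨⟨d, j⟩, h1, h2⟩ := h.nonempty he hP (x := x) (c := c) ⟨(c, 0), by simpa using hc, by simp⟩
  have h3 := hK _ _ h1
  obtain rfl : j = 0 := by
    by_contra hj
    have : (1 : ℤ) * e ≤ j * e := by gcongr; omega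
    simp only at h3
    omega
  exact ⟨d, h2 rfl, by simpa using h1⟩

theorem TailAntitone.ePeriodic (hl : 0 < l) (he : 0 < e) (hP : IsLPartition P)
    (h : TailAntitone e P s) : EPeriodic e P s := by
  obtain ⟨k, hk⟩ := exists_isMaxEntry hl hP s
  have key : ∀ (t : ℕ) (c : Fin l), t + 1 < e → RowHas P s c (k - t) →
      ∃ d ≤ c, RowHas P s d (k - (t + 1 : ℕ)) := fun t c ht hc =>
    h.exists_rowHas_le he hP hk.2 (by push_cast; omega)
      (by rwa [show k - ((t + 1 : ℕ) : ℤ) + 1 = k - t by push_cast; ring])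
  have ex : ∀ t : ℕ, t < e → ∃ c, RowHas P s c (k - t) := by
    intro t
    induction t with
    | zero => intro; simpa using hk.1
    | succ t ih =>
      intro ht
      obtain ⟨c, hc⟩ := ih (by omega)
      obtain ⟨d, -, hd⟩ := key t c ht hc
      exact ⟨d, hd⟩
  have exmin : ∀ t : Fin e, ∃ c, RowHas P s c (k - (t : ℕ)) ∧
      ∀ d, RowHas P s d (k - (t : ℕ)) → c ≤ d := fun t =>
    have hne : {c | RowHas P s c (k - (t : ℕ))}.Nonempty := ex t t.2
    ⟨_, WellFounded.min_mem (wellFounded_lt (α := Fin l)) _ hne,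
      fun d hd => not_lt.1 (WellFounded.not_lt_min wellFounded_lt {c | RowHas P s c (k - (t : ℕ))} hd)⟩
  choose per hper hmin using exmin
  refine ⟨k, per, hk, ?_, fun t => ⟨hper t, hmin t⟩⟩
  have mono : ∀ (n t : ℕ) (ht : t + n < e), per ⟨t + n, ht⟩ ≤ per ⟨t, by omega⟩ := by
    intro n
    induction n with
    | zero => intro t ht; exact le_rfl
    | succ n ih =>
      intro t ht
      obtain ⟨d, hd, hd'⟩ := key (t + n) _ ht (hper ⟨t + n, by omega⟩)
      exact ((hmin ⟨t + (n + 1), ht⟩ d hd').trans hd).trans (ih t (by omega))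
  intro a b hab
  obtain ⟨n, hn⟩ := Nat.exists_eq_add_of_le (Fin.le_def.1 hab)
  have hb : b = ⟨a + n, by omega⟩ := Fin.ext hn
  rw [hb]
  exact mono n a _

/-- The element of the `e`-period congruent to `x` mod `e`. -/
theorem IsEPeriod.exists_mem_tailSet (he : 0 < e) {k : ℤ} {per : Fin e → Fin l}
    (h : IsEPeriod e P s k per) {x : ℤ} {c : Fin l} (hx : (tailSet e P s x c).Nonempty) :
    ∃ (t : Fin e) (j : ℕ), x + j * e = k - ((t : ℕ) : ℤ) ∧ (per t, j) ∈ tailSet e P s x c := by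
  obtain ⟨⟨d, i⟩, h1, h2⟩ := hx
  simp only at h1 h2
  have h3 := h.1.2 _ _ h1
  have hi : (0 : ℤ) ≤ i * e := by positivity
  have he' : (0 : ℤ) < e := by omega
  have hdiv := Int.emod_add_mul_ediv (k - x) e
  have hm0 := Int.emod_nonneg (k - x) he'.ne'
  have hm1 := Int.emod_lt_of_pos (k - x) he'
  have hd0 : 0 ≤ (k - x) / e := Int.ediv_nonneg (by omega) he'.le
  have heq : x + ((k - x) / e).toNat * e = k - (((k - x) % e).toNat : ℕ) := by
    rw [Int.toNat_of_nonneg hd0, Int.toNat_of_nonneg hm0]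
    linarith [mul_comm (e : ℤ) ((k - x) / e)]
  refine ⟨⟨((k - x) % e).toNat, by omega⟩, ((k - x) / e).toNat, heq, ?_, ?_⟩
  · simp only [heq]
    exact (h.2.2 ⟨((k - x) % e).toNat, by omega⟩).1
  · intro h0
    simp only at h0
    rw [h0] at heq
    have hi0 : i = 0 := by
      by_contra hne
      have : (1 : ℤ) * e ≤ i * e := by gcongr; omega
      simp only [Nat.cast_zero, zero_mul] at heq
      omega
    subst hi0
    refine le_trans ((h.2.2 ⟨((k - x) % e).toNat, by omega⟩).2 d ?_) (h2 rfl)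
    simp only [← heq]
    exact h1

theorem DeletesToWith.ncard_tailSet (he : 0 < e) {s' : Charge l} {P' : MP l}
    {k : ℤ} {per : Fin e → Fin l} (h : DeletesToWith e P s k per P' s') (x : ℤ) (c : Fin l) :
    (tailSet e P' s' x c).ncard = (tailSet e P s x c).ncard - 1 := by
  rcases (tailSet e P s x c).eq_empty_or_nonempty with h0 | h0
  · have : tailSet e P' s' x c = ∅ := by
      refine Set.subset_eq_empty (fun q hq => ?_) h0
      exact ⟨((h.rowHas_iff _ _).1 hq.1).1, hq.2⟩
    rw [this, h0, Set.ncard_empty]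
  · obtain ⟨t, j, hj, hmem⟩ := h.1.exists_mem_tailSet he h0
    rw [← Set.ncard_sdiff_singleton_of_mem hmem]
    congr 1
    ext ⟨d, i⟩
    simp only [tailSet, Set.mem_ofPred_eq, Set.mem_sdiff, Set.mem_singleton_iff, h.rowHas_iff,
      Prod.mk.injEq]
    have : (∃ t : Fin e, per t = d ∧ x + i * e = k - ((t : ℕ) : ℤ)) ↔ d = per t ∧ i = j := by
      constructor
      · rintro ⟨u, rfl, hu⟩
        have h1 : ((i : ℤ) - j) * e = (t : ℕ) - (u : ℕ) := by linarith
        have h2 := t.2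
        have h3 := u.2
        have hij : (i : ℤ) - j = 0 := by
          rcases lt_trichotomy ((i : ℤ) - j) 0 with hlt | heq | hgt
          · nlinarith
          · exact heq
          · nlinarith
        rw [hij, zero_mul] at h1
        obtain rfl : u = t := Fin.ext (by omega)
        exact ⟨rfl, by omega⟩
      · rintro ⟨rfl, rfl⟩
        exact ⟨t, rfl, hj⟩
    rw [this]
    tauto

theorem IsEPeriod.tailSet_nonempty (he : 0 < e) {k : ℤ} {per : Fin e → Fin l}
    (h : IsEPeriod e P s k per) {x : ℤ} {c : Fin l} (hx : (tailSet e P s (x + 1) c).Nonempty) :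
    (tailSet e P s x c).Nonempty := by
  obtain ⟨t, j, hj, -, hc⟩ := h.exists_mem_tailSet he hx
  by_cases ht : (t : ℕ) + 1 < e
  · refine ⟨(per ⟨t + 1, ht⟩, j), ?_, fun h0 => ?_⟩
    · have := (h.2.2 ⟨t + 1, ht⟩).1
      rwa [show k - (((⟨t + 1, ht⟩ : Fin e) : ℕ) : ℤ) = x + j * e by push_cast; linarith] at this
    · exact (h.2.1 (Fin.le_def.2 (Nat.le_succ _))).trans (hc h0)
  · refine ⟨(per ⟨0, he⟩, j + 1), ?_, by simp⟩
    have := (h.2.2 ⟨0, he⟩).1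
    have h1 := t.2
    rwa [show k - (((⟨0, he⟩ : Fin e) : ℕ) : ℤ) = x + (j + 1 : ℕ) * e by
      have : (t : ℕ) + 1 = e := by omega
      zify at this
      push_cast
      linarith] at this

theorem DeletesToWith.tailAntitone_iff (he : 0 < e) (hP : IsLPartition P) {s' : Charge l}
    {P' : MP l} {k : ℤ} {per : Fin e → Fin l} (h : DeletesToWith e P s k per P' s') :
    TailAntitone e P' s' ↔ TailAntitone e P s := by
  refine forall₂_congr fun x c => ?_
  rw [h.ncard_tailSet he, h.ncard_tailSet he]
  constructor
  · intro hle
    rcases (tailSet e P s (x + 1) c).eq_empty_or_nonempty with h0 | h0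
    · simp [h0]
    · have := (Set.ncard_pos (tailSet_finite he hP _ _)).2 (h.1.tailSet_nonempty he h0)
      omega
  · intro hle
    omega

theorem tailAntitone_emptyMP (he : 0 < e) (s : Charge l) : TailAntitone e (emptyMP l) s := by
  intro x c
  refine Set.ncard_le_ncard (fun q hq => ?_) (tailSet_finite he ⟨?_, ?_⟩ _ _)
  · refine ⟨?_, hq.2⟩
    have := hq.1
    rw [rowHas_emptyMP] at this ⊢
    omega
  · exact fun _ _ _ _ => le_rfl
  · exact fun _ => ⟨0, fun _ _ => rfl⟩

end Tail

section Epsilon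

variable {l e : ℕ} {P : MP l} {s : Charge l}

theorem remR_sub_addA (P : MP l) (s : Charge l) (c : Fin l) (x : ℤ) :
    remR P s c x - addA P s c x =
      (if RowHas P s c (x + 1) then 1 else 0) - (if RowHas P s c x then 1 else 0) := by
  unfold remR addA
  split_ifs <;> first | rfl | tauto

theorem natCast_ncard_tailSet {K x : ℤ} (hK : ∀ c v, RowHas P s c v → v ≤ K) {N : ℕ}
    (hN : K < x + N * e) (c : Fin l) :
    ((tailSet e P s x c).ncard : ℤ) = ∑ j ∈ Finset.range N, ∑ d : Fin l,
      if j = 0 → d ≤ c then (if RowHas P s d (x + j * e) then 1 else 0) else 0 := by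
  rw [tailSet_eq_coe_filter hK hN, Set.ncard_coe_finset, Finset.card_filter,
    Finset.sum_product_right]
  push_cast
  refine Finset.sum_congr rfl fun j _ => Finset.sum_congr rfl fun d _ => ?_
  split_ifs <;> first | rfl | tauto

theorem suffE_eq_ncard_sub_ncard (he : 0 < e) (hP : IsLPartition P) (x : ℤ) (c : Fin l) :
    suffE e P s (x : ZMod e) x c =
      ((tailSet e P s (x + 1) c).ncard : ℤ) - (tailSet e P s x c).ncard := by
  obtain ⟨K, hK⟩ := exists_forall_rowHas_le hP s
  obtain ⟨N, hN⟩ := exists_lt_add_mul he K x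
  have he' : (0 : ℤ) < e := by omega
  rw [natCast_ncard_tailSet hK hN, natCast_ncard_tailSet hK (N := N) (by omega), suffE]
  have hinj : Function.Injective fun j : ℕ => x + j * e := by
    intro a b hab
    have : (a : ℤ) * e = b * e := by simpa using hab
    exact_mod_cast mul_right_cancel₀ he'.ne' this
  rw [finsum_eq_sum_of_support_subset (s := (Finset.range N).image fun j : ℕ => x + j * e),
    Finset.sum_image fun a _ b _ h => hinj h, ← Finset.sum_sub_distrib]
  · refine Finset.sum_congr rfl fun j _ => ?_
    rw [← Finset.sum_sub_distrib, if_pos (by simp)]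
    rcases Nat.eq_zero_or_pos j with rfl | hj
    · simp only [Nat.cast_zero, zero_mul, add_zero, lt_irrefl, if_false, if_true, suffInf,
        remR_sub_addA, Finset.sum_filter, true_imp_iff]
      refine Finset.sum_congr rfl fun d _ => ?_
      split_ifs <;> rfl
    · have : (0 : ℤ) < j * e := by positivity
      rw [if_pos (by omega)]
      refine Finset.sum_congr rfl fun d _ => ?_
      have h0 : j = 0 → d ≤ c := fun h => absurd h hj.ne'
      rw [remR_sub_addA, if_pos h0, if_pos h0, add_right_comm]
  · intro y hy
    rw [Function.mem_support] at hy
    rw [Finset.coe_image]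
    by_cases hyx : (y : ZMod e) = x
    swap
    · simp [hyx] at hy
    have hyK : y ≤ K := by
      by_contra! hlt
      have h0 : ∀ d, remR P s d y - addA P s d y = 0 := fun d => by
        rw [remR_sub_addA, if_neg fun h => by linarith [hK _ _ h],
          if_neg fun h => by linarith [hK _ _ h], sub_zero]
      simp [suffInf, h0] at hy
    have hxy : x ≤ y := by
      by_contra! hlt
      simp [hlt.not_gt, hlt.ne] at hy
    obtain ⟨z, hz⟩ := (ZMod.intCast_eq_intCast_iff_dvd_sub _ _ _).1 hyx.symm
    have hz0 : 0 ≤ z := by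
      by_contra! hlt
      nlinarith
    lift z to ℕ using hz0
    refine ⟨z, ?_, ?_⟩
    · simp only [Finset.coe_range, Set.mem_Iio]
      by_contra! hle
      have : (N : ℤ) * e ≤ z * e := by gcongr
      linarith [mul_comm (e : ℤ) z]
    · dsimp only
      linarith [mul_comm (e : ℤ) z]

theorem exists_suffE_eq (hl : 0 < l) (he : 0 < e) (i : ZMod e) (x : ℤ) (c : Fin l) :
    ∃ (y : ℤ) (d : Fin l), (y : ZMod e) = i ∧ suffE e P s i x c = suffE e P s i y d := by
  obtain ⟨a, rfl⟩ := ZMod.intCast_surjective i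
  have he' : (0 : ℤ) < e := by omega
  obtain ⟨r, hr0, hre, hr⟩ : ∃ r : ℤ, 0 ≤ r ∧ r < e ∧ (e : ℤ) ∣ a - x - r :=
    ⟨(a - x) % e, Int.emod_nonneg _ he'.ne', Int.emod_lt_of_pos _ he', Int.dvd_self_sub_emod⟩
  have hy : ((x + r : ℤ) : ZMod e) = a := by
    rwa [ZMod.intCast_eq_intCast_iff_dvd_sub, ← sub_sub]
  rcases hr0.eq_or_lt with rfl | hpos
  · exact ⟨x, c, by simpa using hy, rfl⟩
  refine ⟨x + r, ⟨l - 1, by omega⟩, hy, ?_⟩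
  unfold suffE
  congr 1
  funext z
  by_cases hz : (z : ZMod e) = a
  swap
  · simp [hz]
  rw [if_pos hz, if_pos hz]
  obtain ⟨w, hw⟩ := (ZMod.intCast_eq_intCast_iff_dvd_sub _ _ _).1 (hy.trans hz.symm)
  rcases lt_trichotomy w 0 with hlt | rfl | hgt
  · have : z ≤ x + r - e := by nlinarith
    rw [if_neg (by omega), if_neg (by omega), if_neg (by omega), if_neg (by omega)]
  · rw [mul_zero, sub_eq_zero] at hw
    rw [if_pos (by omega), if_neg (by omega), if_pos hw, suffInf]
    refine (Finset.sum_congr (Finset.filter_true_of_mem fun d _ => ?_) fun _ _ => rfl).symm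
    exact Fin.le_def.2 (Nat.le_sub_one_of_lt d.2)
  · have : x + r + e ≤ z := by nlinarith
    rw [if_pos (by omega), if_pos (by omega)]

theorem exists_ncard_tailSet_le_add (he : 0 < e) (hP : IsLPartition P) (s : Charge l) :
    ∃ B : ℕ, ∀ x c, (tailSet e P s (x + 1) c).ncard ≤ B + (tailSet e P s x c).ncard := by
  obtain ⟨K, hK⟩ := exists_forall_rowHas_le hP s
  obtain ⟨m, hm⟩ := exists_forall_le_rowHas hP s
  have he' : (0 : ℤ) < e := by omega
  refine ⟨((Finset.univ : Finset (Fin l)) ×ˢ Finset.Icc m K).card, fun x c => ?_⟩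
  refine (Set.ncard_le_ncard_sdiff_add_ncard _ _ (tailSet_finite he hP x c)).trans
    (Nat.add_le_add_right ?_ _)
  rw [← Set.ncard_coe_finset]
  refine Set.ncard_le_ncard_of_injOn (fun q => (q.1, x + q.2 * e)) ?_ ?_ (Finset.finite_toSet _)
  · rintro ⟨d, j⟩ ⟨h1, h2⟩
    have h3 := hK _ _ h1.1
    have h4 : m < x + j * e := by
      by_contra! hle
      exact h2 ⟨hm _ _ hle, h1.2⟩
    simp only at h3
    simp only [Finset.coe_product, Finset.coe_univ, Finset.coe_Icc, Set.mem_prod, Set.mem_univ,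
      Set.mem_Icc, true_and]
    omega
  · rintro ⟨d, j⟩ - ⟨d', j'⟩ - h
    simp only [Prod.mk.injEq, add_right_inj] at h ⊢
    exact ⟨h.1, by exact_mod_cast mul_right_cancel₀ he'.ne' h.2⟩

theorem epsE_eq_zero_iff_tailAntitone (hl : 0 < l) (he : 0 < e) (hP : IsLPartition P) :
    (∀ i : ZMod e, epsE e P s i = 0) ↔ TailAntitone e P s := by
  have hbdd : ∀ i : ZMod e, BddAbove (insert 0 {z : ℤ | ∃ x c, z = suffE e P s i x c}) := by
    intro i
    obtain ⟨B, hB⟩ := exists_ncard_tailSet_le_add he hP s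
    refine ⟨B, ?_⟩
    rintro z (rfl | ⟨x, c, rfl⟩)
    · positivity
    · obtain ⟨y, d, rfl, hy⟩ := exists_suffE_eq (P := P) (s := s) hl he i x c
      rw [hy, suffE_eq_ncard_sub_ncard he hP]
      have := hB y d
      omega
  constructor
  · intro h x c
    have := (le_csSup (hbdd x) (Set.mem_insert_of_mem _ ⟨x, c, rfl⟩)).trans_eq (h x)
    rw [suffE_eq_ncard_sub_ncard he hP] at this
    omega
  · intro h i
    refine le_antisymm (csSup_le (Set.insert_nonempty _ _) ?_)
      (le_csSup (hbdd i) (Set.mem_insert _ _))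
    rintro z (rfl | ⟨x, c, rfl⟩)
    · exact le_rfl
    · obtain ⟨y, d, rfl, hy⟩ := exists_suffE_eq (P := P) (s := s) hl he i x c
      rw [hy, suffE_eq_ncard_sub_ncard he hP]
      have := h y d
      omega

end Epsilon

section Peeling

variable {l e : ℕ} {P : MP l} {s : Charge l}

theorem eq_emptyMP_of_rowHas_pred (hP : IsLPartition P)
    (h : ∀ c v, RowHas P s c (v + 1) → RowHas P s c v) : P = emptyMP l := by
  funext c i
  have step : ∀ i, P c i ≤ P c (i + 1) := by
    intro i
    obtain ⟨j, hj⟩ := h c (symb P s c i - 1) ⟨i, by ring⟩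
    simp only [symb] at hj
    have hij : i + 1 ≤ j := by
      by_contra! hlt
      have := hP.1 c (Nat.le_of_lt_succ hlt)
      omega
    have := hP.1 c hij
    omega
  obtain ⟨N, hN⟩ := hP.2 c
  have h1 := monotone_nat_of_le_succ step (le_max_left i N)
  have h2 := hN _ (le_max_right i N)
  simp only [emptyMP]
  omega

theorem TailAntitone.eq_emptyMP_and_mem_Tle (he : 0 < e) (hP : IsLPartition P)
    (h : TailAntitone e P s) {M : ℤ} (hM : ∀ c v, RowHas P s c v → v ≤ M)
    (hupper : ∀ v ≤ M, ∀ c d, c ≤ d → RowHas P s c v → RowHas P s d v)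
    (hfull : ∀ c, ∀ v ≤ M - e + 1, RowHas P s c v) : P = emptyMP l ∧ s ∈ Tle l e := by
  have hempty : P = emptyMP l := by
    refine eq_emptyMP_of_rowHas_pred (s := s) hP fun c v hv => ?_
    by_cases hvM : v ≤ M - e + 1
    · exact hfull c v hvM
    · obtain ⟨d, hdc, hd⟩ := h.exists_rowHas_le he hP hM (by omega) hv
      exact hupper v (by linarith [hM _ _ hv]) d c hdc hd
  subst hempty
  simp only [rowHas_emptyMP] at hM hupper hfull
  exact ⟨rfl, fun c d hcd => hupper _ (hM _ _ le_rfl) c d hcd le_rfl, fun c d => by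
    linarith [hM d _ le_rfl, hfull c _ le_rfl]⟩

theorem totallyPeriodic_emptyMP (hs : s ∈ Tle l e) : TotallyPeriodic e (emptyMP l) s :=
  ⟨s, hs, 0, fun _ => (emptyMP l, s), rfl, fun _ h => absurd h (Nat.not_lt_zero _), rfl⟩

theorem DeletesTo.totallyPeriodic {P' : MP l} {s' : Charge l} (h : DeletesTo e P s P' s')
    (h' : TotallyPeriodic e P' s') : TotallyPeriodic e P s := by
  by_cases h0 : P = emptyMP l ∧ s ∈ Tle l e
  · rw [h0.1]
    exact totallyPeriodic_emptyMP h0.2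
  obtain ⟨t, ht, n, g, hg0, hg, hgn⟩ := h'
  refine ⟨t, ht, n + 1, fun m => Nat.casesOn m (P, s) g, rfl, ?_, hgn⟩
  rintro (_ | m) hm
  · refine ⟨h0, ?_⟩
    change DeletesTo e P s (g 0).1 (g 0).2
    rwa [hg0]
  · exact hg m (by omega)

theorem TotallyPeriodic.tailAntitone (he : 0 < e) (hP : IsLPartition P)
    (h : TotallyPeriodic e P s) : TailAntitone e P s := by
  obtain ⟨t, -, n, g, hg0, hg, hgn⟩ := h
  induction n generalizing P s g with
  | zero =>
    obtain ⟨rfl, rfl⟩ := Prod.mk.inj (hg0.symm.trans hgn)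
    exact tailAntitone_emptyMP he s
  | succ n ih =>
    obtain ⟨k, per, hdel⟩ := (hg 0 (by omega)).2
    rw [hg0] at hdel
    exact (hdel.tailAntitone_iff he hP).1
      (ih hdel.2.1 (fun m => g (m + 1)) rfl (fun m hm => hg (m + 1) (by omega)) hgn)

theorem entries_gt_finite (hP : IsLPartition P) (s : Charge l) (M : ℤ) :
    {q : Fin l × ℤ | RowHas P s q.1 q.2 ∧ M < q.2}.Finite := by
  obtain ⟨K, hK⟩ := exists_forall_rowHas_le hP s
  refine (Set.finite_univ.prod (Set.finite_Icc M K)).subset fun q hq => ?_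
  exact ⟨Set.mem_univ _, hq.2.le, hK _ _ hq.1⟩

theorem TailAntitone.totallyPeriodic (hl : 0 < l) (he : 0 < e) (hP : IsLPartition P)
    (h : TailAntitone e P s) : TotallyPeriodic e P s := by
  obtain ⟨M, hM⟩ := exists_forall_le_rowHas hP s
  have hupper : ∀ v ≤ M, ∀ c d, c ≤ d → RowHas P s c v → RowHas P s d v :=
    fun v hv c d _ _ => hM d v hv
  have hfull : ∀ c, ∀ v ≤ M - e + 1, RowHas P s c v := fun c v hv => hM c v (by omega)
  clear hM
  induction hn : {q : Fin l × ℤ | RowHas P s q.1 q.2 ∧ M < q.2}.ncard using Nat.strong_induction_on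
    generalizing P s with
  | _ n ih =>
  by_cases hmax : ∀ c v, RowHas P s c v → v ≤ M
  · obtain ⟨rfl, hs⟩ := h.eq_emptyMP_and_mem_Tle he hP hmax hupper hfull
    exact totallyPeriodic_emptyMP hs
  push Not at hmax
  obtain ⟨c, v, hv, hMv⟩ := hmax
  obtain ⟨k, per, hper⟩ := h.ePeriodic hl he hP
  obtain ⟨P', s', hdel⟩ := exists_deletesToWith hP hper
  have hk : M < k := hMv.trans_le (hper.1.2 _ _ hv)
  refine DeletesTo.totallyPeriodic ⟨k, per, hdel⟩
    (ih _ ?_ hdel.2.1 ((hdel.tailAntitone_iff he hP).2 h) ?_ ?_ rfl)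
  · rw [← hn]
    refine Set.ncard_lt_ncard ?_ (entries_gt_finite hP s M)
    refine ⟨fun q hq => ⟨((hdel.rowHas_iff _ _).1 hq.1).1, hq.2⟩, fun hsub => ?_⟩
    have h0 := (hper.2.2 ⟨0, he⟩).1
    simp only [Nat.cast_zero, sub_zero] at h0
    have := @hsub (per ⟨0, he⟩, k) ⟨h0, hk⟩
    exact ((hdel.rowHas_iff _ _).1 this.1).2 ⟨⟨0, he⟩, rfl, by simp⟩
  · intro v hv c d hcd hc
    rw [hdel.rowHas_iff] at hc ⊢
    refine ⟨hupper v hv c d hcd hc.1, ?_⟩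
    rintro ⟨t, rfl, rfl⟩
    exact hc.2 ⟨t, le_antisymm ((hper.2.2 t).2 c hc.1) hcd, rfl⟩
  · intro c v hv
    rw [hdel.rowHas_iff]
    refine ⟨hfull c v hv, ?_⟩
    rintro ⟨t, -, rfl⟩
    have := t.2
    omega

end Peeling

/-- `λ` is a highest weight vertex of `G_{e,s}` (i.e. `ε_i(λ) = 0` for
every `i ∈ ℤ/eℤ`) if and only if `(λ,s)` is totally periodic. -/
theorem highestWeight_iff_totallyPeriodic {l e : ℕ} (hl : 0 < l) (he : 2 ≤ e)
    (P : MP l) (s : Charge l) (hP : IsLPartition P) :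
    (∀ i : ZMod e, epsE e P s i = 0) ↔ TotallyPeriodic e P s := by
  rw [epsE_eq_zero_iff_tailAntitone hl (by omega) hP]
  exact ⟨fun h => h.totallyPeriodic hl (by omega) hP, fun h => h.tailAntitone (by omega) hP⟩

end FockHW
end
end

section
/- Let e ≥ 2, s ∈ ℤ^l and λ an l-partition such that (λ,s) is e-periodic. Then for every i ∈ ℤ/eℤ one has φ_i(λ⁻) = φ_i(λ) and ε_i(λ⁻) = ε_i(λ), where φ_i(λ⁻), ε_i(λ⁻) are computed with respect to the multicharge s⁻. -/
/- Formalization of combinatorial notions from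
   "A combinatorial decomposition of higher level Fock spaces"
   by N. Jacon and C. Lecouvey. -/

open scoped Classical

noncomputable section

namespace FockHW

/-- The indicator (valued in `ℤ`) of the entries of row `c` of the symbol. -/
def rowInd {l : ℕ} (P : MP l) (s : Charge l) (c : Fin l) (x : ℤ) : ℤ :=
  if RowHas P s c x then 1 else 0

/-- The contribution `#A - #R` of the nodes of content `x` in component `c`. -/
def nodeWt {l : ℕ} (P : MP l) (s : Charge l) (c : Fin l) (x : ℤ) : ℤ :=
  rowInd P s c x - rowInd P s c (x + 1)

lemma addA_sub_remR {l : ℕ} (P : MP l) (s : Charge l) (c : Fin l) (x : ℤ) :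
    addA P s c x - remR P s c x = nodeWt P s c x := by
  unfold addA remR nodeWt rowInd
  split_ifs <;> simp_all

/-- The value `#A - #R` of the part of the `i`-word made of the nodes of content `< x0`
and of the nodes of content `x0` in the components belonging to `S`. -/
def partialWt {l : ℕ} (e : ℕ) (P : MP l) (s : Charge l) (i : ZMod e) (x0 : ℤ)
    (S : Finset (Fin l)) : ℤ :=
  ∑ᶠ x : ℤ, if (x : ZMod e) = i then
      (if x < x0 then ∑ c : Fin l, nodeWt P s c x
       else if x = x0 then ∑ c ∈ S, nodeWt P s c x else 0)
    else 0

/-- The value `#A - #R` of the whole `i`-word. -/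
def totalWt {l : ℕ} (e : ℕ) (P : MP l) (s : Charge l) (i : ZMod e) : ℤ :=
  ∑ᶠ x : ℤ, if (x : ZMod e) = i then ∑ c : Fin l, nodeWt P s c x else 0

lemma prefE_eq {l : ℕ} (e : ℕ) (P : MP l) (s : Charge l) (i : ZMod e) (x0 : ℤ) (c0 : Fin l) :
    prefE e P s i x0 c0 =
      partialWt e P s i x0 (Finset.univ.filter (fun c : Fin l => c0 ≤ c)) := by
  simp only [prefE, prefInf, partialWt, addA_sub_remR]

/-- All nodes have content in `[m, M)`. -/
def NodesWithin {l : ℕ} (P : MP l) (s : Charge l) (m M : ℤ) : Prop :=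
  ∀ c x, x < m ∨ M ≤ x → nodeWt P s c x = 0

lemma NodesWithin.finite_support {l : ℕ} {P : MP l} {s : Charge l} {m M : ℤ}
    (h : NodesWithin P s m M) (f : ℤ → ℤ) (hf : ∀ x, (∀ c, nodeWt P s c x = 0) → f x = 0) :
    (Function.support f).Finite := by
  refine (Set.finite_Ico m M).subset fun x hx => ?_
  by_contra hx'
  refine hx (hf x fun c => h c x ?_)
  simp only [Set.mem_Ico] at hx'
  omega

lemma suffE_eq {l e : ℕ} {P : MP l} {s : Charge l} {m M : ℤ} (h : NodesWithin P s m M)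
    (i : ZMod e) (x0 : ℤ) (c0 : Fin l) :
    suffE e P s i x0 c0 =
      partialWt e P s i x0 (Finset.univ.filter (fun c : Fin l => c0 < c))
        - totalWt e P s i := by
  have hneg : ∀ c x, remR P s c x - addA P s c x = - nodeWt P s c x := fun c x => by
    rw [← addA_sub_remR]; ring
  unfold partialWt totalWt suffE suffInf
  rw [← finsum_sub_distrib (h.finite_support _ ?_) (h.finite_support _ ?_)]
  · refine finsum_congr fun x => ?_
    simp only [hneg, Finset.sum_neg_distrib]
    rcases lt_trichotomy x x0 with hx | rfl | hx
    · simp [hx, hx.not_gt, hx.ne]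
    · have := Finset.sum_filter_add_sum_filter_not (Finset.univ : Finset (Fin l))
        (fun c => c ≤ c0) (fun c => nodeWt P s c x)
      simp only [not_le] at this
      simp only [lt_irrefl, if_true, if_false, ← this]
      split_ifs <;> ring
    · simp only [hx, hx.not_gt, hx.ne', if_true, if_false]
      split_ifs <;> simp
  · intro x hx; simp [hx]
  · intro x hx; simp [hx]

lemma partialWt_eq_add {l e : ℕ} {P : MP l} {s : Charge l} {m M : ℤ} (h : NodesWithin P s m M)
    (i : ZMod e) (x0 : ℤ) (S : Finset (Fin l)) :
    partialWt e P s i x0 S =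
      partialWt e P s i x0 ∅ + if (x0 : ZMod e) = i then ∑ c ∈ S, nodeWt P s c x0 else 0 := by
  have hs : (if (x0 : ZMod e) = i then ∑ c ∈ S, nodeWt P s c x0 else 0) =
      ∑ᶠ x : ℤ, if x = x0 then
        (if (x : ZMod e) = i then ∑ c ∈ S, nodeWt P s c x else 0) else 0 := by
    rw [finsum_eq_single _ x0 (fun x hx => by simp [hx])]
    simp
  rw [hs]
  unfold partialWt
  rw [← finsum_add_distrib (h.finite_support _ ?_) (h.finite_support _ ?_)]
  · refine finsum_congr fun x => ?_
    rcases lt_trichotomy x x0 with hx | rfl | hx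
    · simp [hx, hx.ne]
    · simp
    · simp [hx.not_gt, hx.ne']
  · intro x hx; simp [hx]
  · intro x hx; simp [hx]

lemma partialWt_succ {l : ℕ} (e : ℕ) (P : MP l) (s : Charge l) (i : ZMod e) (x0 : ℤ) :
    partialWt e P s i (x0 + 1) ∅ = partialWt e P s i x0 Finset.univ := by
  refine finsum_congr fun x => ?_
  rcases lt_trichotomy x x0 with hx | rfl | hx
  · simp [hx, hx.trans (lt_add_one x0)]
  · simp
  · have : ¬ x < x0 + 1 := by omega
    simp [hx.not_gt, hx.ne', this]

lemma NodesWithin.partialWt_of_le {l e : ℕ} {P : MP l} {s : Charge l} {m M : ℤ}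
    (h : NodesWithin P s m M) (i : ZMod e) {x0 : ℤ} (hx0 : x0 ≤ m) :
    partialWt e P s i x0 ∅ = 0 := by
  unfold partialWt
  rw [← finsum_zero (α := ℤ)]
  refine finsum_congr fun x => ?_
  by_cases hx : x < x0
  · simp [fun c => h c x (Or.inl (hx.trans_le hx0))]
  · simp [hx]

lemma NodesWithin.partialWt_of_ge {l e : ℕ} {P : MP l} {s : Charge l} {m M : ℤ}
    (h : NodesWithin P s m M) (i : ZMod e) {x0 : ℤ} (hx0 : M ≤ x0) :
    partialWt e P s i x0 ∅ = totalWt e P s i := by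
  refine finsum_congr fun x => ?_
  by_cases hx : x < x0
  · simp [hx]
  · simp [fun c => h c x (Or.inr (hx0.trans (not_lt.1 hx)))]

/-- The values `#A - #R` of all prefixes of the `i`-word. -/
def prefixVals {l : ℕ} (e : ℕ) (P : MP l) (s : Charge l) (i : ZMod e) : Set ℤ :=
  {z | ∃ x0, ∃ S : Finset (Fin l), IsUpperSet (S : Set (Fin l)) ∧ z = partialWt e P s i x0 S}

lemma insert_prefE {l e : ℕ} (hl : 0 < l) {P : MP l} {s : Charge l} {m M : ℤ}
    (h : NodesWithin P s m M) (i : ZMod e) :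
    insert 0 {z : ℤ | ∃ x0 c0, z = prefE e P s i x0 c0} = prefixVals e P s i := by
  ext z
  simp only [Set.mem_insert_iff, Set.mem_ofPred_eq, prefE_eq, prefixVals]
  constructor
  · rintro (rfl | ⟨x0, c0, rfl⟩)
    · exact ⟨m, ∅, by simp [IsUpperSet], (h.partialWt_of_le i le_rfl).symm⟩
    · refine ⟨x0, _, ?_, rfl⟩
      intro a b hab ha
      simp only [Finset.coe_filter, Finset.mem_univ, true_and, Set.mem_ofPred_eq] at ha ⊢
      exact ha.trans hab
  · rintro ⟨x0, S, hS, rfl⟩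
    right
    rcases S.eq_empty_or_nonempty with rfl | hne
    · refine ⟨x0 - 1, ⟨0, hl⟩, ?_⟩
      have := partialWt_succ e P s i (x0 - 1)
      rw [sub_add_cancel] at this
      rw [this]
      congr 1
      ext c
      simp [Fin.le_def]
    · refine ⟨x0, S.min' hne, ?_⟩
      congr 1
      ext c
      simp only [Finset.mem_filter, Finset.mem_univ, true_and]
      exact ⟨fun hc => S.min'_le c hc, fun hc => hS hc (S.min'_mem hne)⟩

lemma insert_suffE {l e : ℕ} (hl : 0 < l) {P : MP l} {s : Charge l} {m M : ℤ}
    (h : NodesWithin P s m M) (i : ZMod e) :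
    insert 0 {z : ℤ | ∃ x0 c0, z = suffE e P s i x0 c0} =
      (fun z => z - totalWt e P s i) '' prefixVals e P s i := by
  ext z
  simp only [Set.mem_insert_iff, Set.mem_ofPred_eq, suffE_eq h, prefixVals, Set.mem_image]
  constructor
  · rintro (rfl | ⟨x0, c0, rfl⟩)
    · exact ⟨_, ⟨M, ∅, by simp [IsUpperSet], rfl⟩, by rw [h.partialWt_of_ge i le_rfl, sub_self]⟩
    · refine ⟨_, ⟨x0, _, ?_, rfl⟩, rfl⟩
      intro a b hab ha
      simp only [Finset.coe_filter, Finset.mem_univ, true_and, Set.mem_ofPred_eq] at ha ⊢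
      exact ha.trans_le hab
  · rintro ⟨_, ⟨x0, S, hS, rfl⟩, rfl⟩
    right
    rcases Sᶜ.eq_empty_or_nonempty with he | hne
    · refine ⟨x0 + 1, ⟨l - 1, by omega⟩, ?_⟩
      rw [Finset.compl_eq_empty_iff] at he
      rw [he, ← partialWt_succ]
      congr 2
      ext c
      have := c.2
      simp only [Finset.notMem_empty, Finset.mem_filter, Finset.mem_univ, true_and, Fin.lt_def,
        false_iff]
      omega
    · refine ⟨x0, Sᶜ.max' hne, ?_⟩
      congr 2
      ext c
      have hm := Sᶜ.max'_mem hne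
      rw [Finset.mem_compl] at hm
      simp only [Finset.mem_filter, Finset.mem_univ, true_and]
      constructor
      · intro hc
        by_contra hlt
        exact hm (hS (not_lt.1 hlt) hc)
      · intro hc
        by_contra hcS
        exact (Sᶜ.le_max' c (Finset.mem_compl.2 hcS)).not_gt hc

lemma IsLPartition.exists_lower {l : ℕ} {P : MP l} (hP : IsLPartition P) (s : Charge l) :
    ∃ m : ℤ, ∀ c x, x ≤ m → RowHas P s c x := by
  choose N hN using hP.2
  obtain ⟨m, hm⟩ := (Set.finite_range fun c => s c - (N c : ℤ)).bddBelow
  refine ⟨m, fun c x hx => ⟨(s c - x).toNat, ?_⟩⟩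
  have h1 : m ≤ s c - N c := hm ⟨c, rfl⟩
  unfold symb
  rw [hN c _ (by omega)]
  push_cast
  omega

lemma nodesWithin_of_bounds {l : ℕ} {P : MP l} {s : Charge l} {m m' k : ℤ}
    (hm : ∀ c x, x ≤ m → RowHas P s c x) (hk : ∀ c v, RowHas P s c v → v ≤ k) (hmm : m' ≤ m) :
    NodesWithin P s m' (k + 1) := by
  rintro c x (hx | hx)
  · simp [nodeWt, rowInd, hm c x (by omega), hm c (x + 1) (by omega)]
  · have h1 : ¬ RowHas P s c x := fun h => by have := hk c x h; omega
    have h2 : ¬ RowHas P s c (x + 1) := fun h => by have := hk c _ h; omega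
    simp [nodeWt, rowInd, h1, h2]

/-- The indicator (valued in `ℤ`) of the period entries in row `c`. -/
def perInd {l e : ℕ} (k : ℤ) (per : Fin e → Fin l) (c : Fin l) (x : ℤ) : ℤ :=
  if ∃ t : Fin e, per t = c ∧ x = k - ((t : ℕ) : ℤ) then 1 else 0

lemma sum_perInd {l e : ℕ} (k : ℤ) (per : Fin e → Fin l) (S : Finset (Fin l)) (x : ℤ) :
    ∑ c ∈ S, perInd k per c x =
      if ∃ t : Fin e, per t ∈ S ∧ x = k - ((t : ℕ) : ℤ) then 1 else 0 := by
  split_ifs with h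
  · obtain ⟨t, ht, rfl⟩ := h
    rw [Finset.sum_eq_single_of_mem _ ht]
    · exact if_pos ⟨t, rfl, rfl⟩
    · intro c _ hc
      refine if_neg ?_
      rintro ⟨t', rfl, h'⟩
      exact hc (congrArg per (Fin.ext (by omega)))
  · refine Finset.sum_eq_zero fun c hc => if_neg ?_
    rintro ⟨t, rfl, ht⟩
    exact h ⟨t, hc, ht⟩

lemma sum_univ_perInd {l e : ℕ} (k : ℤ) (per : Fin e → Fin l) (x : ℤ) :
    ∑ c, perInd k per c x = if k - e < x ∧ x ≤ k then 1 else 0 := by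
  rw [sum_perInd]
  refine if_congr ⟨?_, fun h => ⟨⟨(k - x).toNat, by omega⟩, Finset.mem_univ _, ?_⟩⟩ rfl rfl
  · rintro ⟨t, -, rfl⟩
    have := t.2
    omega
  · simp only; omega

section Deletion

variable {l e : ℕ} {P P' : MP l} {s s' : Charge l} {k : ℤ} {per : Fin e → Fin l}

lemma DeletesToWith.rowInd_eq (h : DeletesToWith e P s k per P' s') (c : Fin l) (x : ℤ) :
    rowInd P' s' c x = rowInd P s c x - perInd k per c x := by
  have hc : RowHas P' s' c x ↔
      RowHas P s c x ∧ ¬ ∃ t : Fin e, per t = c ∧ x = k - ((t : ℕ) : ℤ) :=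
    Set.ext_iff.1 (h.2.2 c) x
  have hp : (∃ t : Fin e, per t = c ∧ x = k - ((t : ℕ) : ℤ)) → RowHas P s c x := by
    rintro ⟨t, rfl, rfl⟩
    exact (h.1.2.2 t).1
  unfold rowInd perInd
  rw [hc]
  split_ifs <;> simp_all

lemma DeletesToWith.sum_nodeWt (h : DeletesToWith e P s k per P' s') (S : Finset (Fin l))
    (x : ℤ) :
    ∑ c ∈ S, nodeWt P s c x = ∑ c ∈ S, nodeWt P' s' c x +
      (∑ c ∈ S, perInd k per c x - ∑ c ∈ S, perInd k per c (x + 1)) := by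
  rw [← Finset.sum_sub_distrib, ← Finset.sum_add_distrib]
  refine Finset.sum_congr rfl fun c _ => ?_
  unfold nodeWt
  rw [h.rowInd_eq, h.rowInd_eq]
  ring

lemma DeletesToWith.partialWt_empty {m M : ℤ} (h : DeletesToWith e P s k per P' s')
    (hN : NodesWithin P s m M) (hN' : NodesWithin P' s' m M) (hm : m ≤ k - e)
    (i : ZMod e) (x : ℤ) :
    partialWt e P s i x ∅ = partialWt e P' s' i x ∅ -
      if (k : ZMod e) = i ∧ k - e < x ∧ x ≤ k then 1 else 0 := by
  rcases le_total x m with hx | hx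
  · rw [hN.partialWt_of_le i hx, hN'.partialWt_of_le i hx, if_neg (by omega), sub_zero]
  · induction x, hx using Int.leInduction with
    | base =>
      rw [hN.partialWt_of_le i le_rfl, hN'.partialWt_of_le i le_rfl, if_neg (by omega), sub_zero]
    | succ x hx ih =>
      rw [partialWt_succ, partialWt_succ, partialWt_eq_add hN, partialWt_eq_add hN', ih,
        h.sum_nodeWt, sum_univ_perInd, sum_univ_perInd]
      have hke : ((k - e : ℤ) : ZMod e) = k := by simp
      have hxk : x = k → (x : ZMod e) = k := by rintro rfl; rfl
      have hxk' : x = k - e → (x : ZMod e) = k := by rintro rfl; exact hke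
      by_cases hki : (k : ZMod e) = i <;> by_cases hxi : (x : ZMod e) = i
      · simp only [hki, hxi, true_and, if_true]
        split_ifs <;> omega
      · have h1 : x ≠ k := fun h => hxi ((hxk h).trans hki)
        have h2 : x ≠ k - e := fun h => hxi ((hxk' h).trans hki)
        simp only [hki, hxi, true_and, if_false]
        split_ifs <;> omega
      · have h1 : x ≠ k := fun h => hki ((hxk h).symm.trans hxi)
        have h2 : x ≠ k - e := fun h => hki ((hxk' h).symm.trans hxi)
        simp only [hki, hxi, false_and, if_true, if_false]
        split_ifs <;> omega
      · simp only [hki, hxi, false_and, if_false]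
        omega

lemma int_eq_of_cast_eq {x k : ℤ} (h : (x : ZMod e) = (k : ZMod e)) (h1 : k - e < x)
    (h2 : x ≤ k) : x = k := by
  rw [ZMod.intCast_eq_intCast_iff_dvd_sub] at h
  have := Int.eq_zero_of_dvd_of_nonneg_of_lt (by omega) (by omega) h
  omega

lemma rowInd_nonneg (P : MP l) (s : Charge l) (c : Fin l) (x : ℤ) : 0 ≤ rowInd P s c x := by
  unfold rowInd
  split_ifs <;> simp

lemma partialWt_le_succ {m M : ℤ} (hN : NodesWithin P s m M) (i : ZMod e) (x : ℤ)
    (S : Finset (Fin l))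
    (hS : (x : ZMod e) = i → ∀ c ∉ S, ¬ RowHas P s c (x + 1)) :
    partialWt e P s i x S ≤ partialWt e P s i (x + 1) ∅ := by
  rw [partialWt_succ, partialWt_eq_add hN, partialWt_eq_add hN i x Finset.univ]
  split_ifs with hx
  · gcongr _ + ?_
    refine Finset.sum_le_sum_of_subset_of_nonneg (Finset.subset_univ _) fun c _ hc => ?_
    have := rowInd_nonneg P s c x
    have h0 : rowInd P s c (x + 1) = 0 := if_neg (hS hx c hc)
    unfold nodeWt
    omega
  · exact le_rfl

lemma DeletesToWith.upperBounds_prefixVals {m M : ℤ} (h : DeletesToWith e P s k per P' s')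
    (hN : NodesWithin P s m M) (hN' : NodesWithin P' s' m M) (hm : m ≤ k - e) (i : ZMod e) :
    upperBounds (prefixVals e P' s' i) = upperBounds (prefixVals e P s i) := by
  have hD := h.partialWt_empty hN hN' hm i
  have hsub : ∀ c v, RowHas P' s' c v → RowHas P s c v := fun c v hv =>
    ((Set.ext_iff.1 (h.2.2 c) v).1 hv).1
  have hF : ∀ x S, partialWt e P s i x S = partialWt e P' s' i x S -
      (if (k : ZMod e) = i ∧ k - e < x ∧ x ≤ k then 1 else 0) +
      if (x : ZMod e) = i then
        ((if ∃ t : Fin e, per t ∈ S ∧ x = k - ((t : ℕ) : ℤ) then 1 else 0) -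
          if ∃ t : Fin e, per t ∈ S ∧ x + 1 = k - ((t : ℕ) : ℤ) then 1 else 0) else 0 := by
    intro x S
    rw [partialWt_eq_add hN, partialWt_eq_add hN', hD, h.sum_nodeWt, sum_perInd, sum_perInd]
    by_cases hx : (x : ZMod e) = i
    · rw [if_pos hx, if_pos hx, if_pos hx]; ring
    · rw [if_neg hx, if_neg hx, if_neg hx]; ring
  have hempty : IsUpperSet ((∅ : Finset (Fin l)) : Set (Fin l)) := by simp [IsUpperSet]
  ext b
  simp only [mem_upperBounds, prefixVals, Set.mem_ofPred_eq]
  constructor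
  · rintro hb _ ⟨x, S, hS, rfl⟩
    refine le_trans ?_ (hb _ ⟨x, S, hS, rfl⟩)
    rw [hF x S]
    by_cases hx : (x : ZMod e) = i
    · by_cases ha : ∃ t : Fin e, per t ∈ S ∧ x = k - ((t : ℕ) : ℤ)
      · obtain ⟨t, htS, ht⟩ := id ha
        have htlt := t.2
        by_cases ht0 : (t : ℕ) = 0
        · have hxk : x = k := by omega
          rw [if_pos (⟨hxk ▸ hx, by omega, by omega⟩ : (k : ZMod e) = i ∧ k - e < x ∧ x ≤ k)]
          split_ifs <;> omega
        · have hb1 : ∃ t : Fin e, per t ∈ S ∧ x + 1 = k - ((t : ℕ) : ℤ) := by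
            refine ⟨⟨t - 1, by omega⟩, hS (h.1.2.1 ?_) htS, ?_⟩
            · rw [Fin.le_def]; simp
            · simp only; omega
          rw [if_pos ha, if_pos hb1]
          split_ifs <;> omega
      · rw [if_neg ha]
        split_ifs <;> omega
    · rw [if_neg hx]
      split_ifs <;> omega
  · rintro hb _ ⟨x, S, hS, rfl⟩
    have hlast : (k : ZMod e) = i → ∀ y, k - e < y → y ≤ k + 1 →
        partialWt e P' s' i y ∅ ≤ b := by
      intro hki y hy hy'
      have hbase : partialWt e P' s' i (k + 1) ∅ ≤ b := by
        have := hD (k + 1)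
        rw [if_neg (by omega), sub_zero] at this
        rw [← this]
        exact hb _ ⟨k + 1, ∅, hempty, rfl⟩
      induction y, hy' using Int.leInductionDown with
      | base => exact hbase
      | pred y hy' ih =>
        refine le_trans ?_ (ih (by omega))
        have := partialWt_le_succ hN' i (y - 1) ∅ ?_
        · rwa [sub_add_cancel] at this
        · intro hyi c _ hrow
          have hyk := int_eq_of_cast_eq (hyi.trans hki.symm) hy (by omega)
          have := h.1.1.2 c _ (hsub c _ hrow)
          omega
    have hnext : partialWt e P' s' i x S ≤ partialWt e P' s' i (x + 1) ∅ →
        partialWt e P' s' i x S ≤ b := by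
      intro hle
      refine hle.trans ?_
      by_cases hx : (k : ZMod e) = i ∧ k - e < x + 1 ∧ x + 1 ≤ k
      · exact hlast hx.1 _ hx.2.1 (by omega)
      · have := hD (x + 1)
        rw [if_neg hx, sub_zero] at this
        rw [← this]
        exact hb _ ⟨x + 1, ∅, hempty, rfl⟩
    by_cases hcase : (x : ZMod e) = i → x = k ∨ ∃ t : Fin e, per t ∈ S ∧ x + 1 = k - ((t : ℕ) : ℤ)
    · refine hnext (partialWt_le_succ hN' i x S fun hx c hc hrow => ?_)
      have hrow := hsub c _ hrow
      rcases hcase hx with rfl | ⟨t, htS, ht⟩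
      · have := h.1.1.2 c _ hrow
        omega
      · rw [ht] at hrow
        exact hc (hS ((h.1.2.2 t).2 c hrow) htS)
    · push Not at hcase
      obtain ⟨hx, hxk, ht⟩ := hcase
      refine le_trans ?_ (hb _ ⟨x, S, hS, rfl⟩)
      have h1 : ¬ ((k : ZMod e) = i ∧ k - e < x ∧ x ≤ k) := fun ⟨h1, h2, h3⟩ =>
        hxk (int_eq_of_cast_eq (hx.trans h1.symm) h2 h3)
      have h2 : ¬ ∃ t : Fin e, per t ∈ S ∧ x + 1 = k - ((t : ℕ) : ℤ) := fun ⟨t, h2, h3⟩ =>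
        ht t h2 h3
      rw [hF x S, if_neg h1, if_neg h2]
      split_ifs <;> omega

end Deletion

lemma sSup_eq_of_upperBounds_eq {A B : Set ℤ} (hA : A.Nonempty) (hB : B.Nonempty)
    (h : upperBounds A = upperBounds B) : sSup A = sSup B := by
  by_cases hb : BddAbove A
  · have hb' : BddAbove B := by rwa [BddAbove, ← h]
    have hlub := isLUB_csSup hA hb
    rw [IsLUB, h] at hlub
    exact hlub.unique (isLUB_csSup hB hb')
  · have hb' : ¬ BddAbove B := by rwa [BddAbove, ← h]
    rw [csSup_of_not_bddAbove hb, csSup_of_not_bddAbove hb']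

lemma upperBounds_image_sub (A : Set ℤ) (T : ℤ) :
    upperBounds ((fun z => z - T) '' A) = {b | b + T ∈ upperBounds A} := by
  ext b
  simp [mem_upperBounds]

/-- deleting the `e`-period does not change `φ_i` and `ε_i`. -/
theorem phi_eps_eq_of_deletesTo {l e : ℕ} (hl : 0 < l) (he : 2 ≤ e)
    (P : MP l) (s : Charge l) (hP : IsLPartition P)
    (P' : MP l) (s' : Charge l) (h : DeletesTo e P s P' s') :
    ∀ i : ZMod e, phiE e P' s' i = phiE e P s i ∧ epsE e P' s' i = epsE e P s i := by
  intro i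
  obtain ⟨k, per, h⟩ := h
  obtain ⟨m₁, hm₁⟩ := hP.exists_lower s
  obtain ⟨m₂, hm₂⟩ := h.2.1.exists_lower s'
  have hk' : ∀ c v, RowHas P' s' c v → v ≤ k := fun c v hv =>
    h.1.1.2 c v ((Set.ext_iff.1 (h.2.2 c) v).1 hv).1
  have hN : NodesWithin P s (min (min m₁ m₂) (k - e)) (k + 1) :=
    nodesWithin_of_bounds hm₁ h.1.1.2 (by omega)
  have hN' : NodesWithin P' s' (min (min m₁ m₂) (k - e)) (k + 1) :=
    nodesWithin_of_bounds hm₂ hk' (by omega)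
  have hub := h.upperBounds_prefixVals hN hN' (min_le_right _ _) i
  have hT : totalWt e P s i = totalWt e P' s' i := by
    have := h.partialWt_empty hN hN' (min_le_right _ _) i (k + 1)
    rwa [if_neg (by omega), sub_zero, hN.partialWt_of_ge i le_rfl,
      hN'.partialWt_of_ge i le_rfl] at this
  constructor
  · refine sSup_eq_of_upperBounds_eq (Set.insert_nonempty _ _) (Set.insert_nonempty _ _) ?_
    rw [insert_prefE hl hN, insert_prefE hl hN', hub]
  · refine sSup_eq_of_upperBounds_eq (Set.insert_nonempty _ _) (Set.insert_nonempty _ _) ?_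
    rw [insert_suffE hl hN, insert_suffE hl hN', upperBounds_image_sub, upperBounds_image_sub,
      hub, hT]

end FockHW
end
end
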